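/- Let (L, w)/(K, v) be a finite separable extension of henselian valued fields (w the unique extension of v to L). Then the image of the norm map N_{L/K}: L^× → K^× is open in K^× with respect to the v-adic topology. More precisely, if α ∈ 𝒪_w satisfies Tr_{L/K}(α) ≠ 0, then every x ∈ K with v(x) > 2·v(Tr_{L/K}(α)) satisfies 1 + x ∈ N_{L/K}(L^×). -/

import Mathlib

open Polynomial IsLocalRing

open scoped Pointwise in
/-- If a finite group acts on a domain with henselian local ring of invariants,
then the domain is local. -/
theorem IsLocalRing.of_isInvariant_of_henselian (A B G : Type*) [CommRing A] [HenselianLocalRing A]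
    [CommRing B] [IsDomain B] [Algebra A B] [Group G] [Finite G] [MulSemiringAction G B]
    [SMulCommClass G A B] [Algebra.IsInvariant A B G] : IsLocalRing B := by
  classical
  cases nonempty_fintype G
  have hint : Algebra.IsIntegral A B := Algebra.IsInvariant.isIntegral A B G
  have hunder (M : Ideal B) [M.IsMaximal] : M.under A = maximalIdeal A :=
    eq_maximalIdeal (Ideal.isMaximal_comap_of_isIntegral_of_isMaximal M)
  have hmem (M : Ideal B) [M.IsMaximal] (a : A) : algebraMap A B a ∈ M ↔ a ∈ maximalIdeal A := by
    rw [← hunder M]; rfl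
  obtain ⟨M, hM⟩ := Ideal.exists_maximal B
  refine .of_unique_max_ideal ⟨M, hM, fun M' hM' ↦ ?_⟩
  by_contra hne
  obtain ⟨τ, rfl⟩ := Algebra.IsInvariant.exists_smul_of_under_eq A B G M M'
    ((hunder M).trans (hunder M').symm)
  -- an element congruent to `1` modulo `M` and lying in all other conjugates of `M`
  let J : Ideal B := (Finset.univ.filter fun g : G ↦ g • M ≠ M).inf fun g ↦ g • M
  have hJ : ¬ J ≤ M := by
    rw [Ideal.IsPrime.inf_le' inferInstance]
    rintro ⟨g, hg, hle⟩
    exact (Finset.mem_filter.mp hg).2 (smul_eq_of_smul_le hle)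
  obtain ⟨s, hs, b, hb, hsb⟩ := Submodule.mem_sup.mp
    ((Ideal.eq_top_iff_one _).mp (hM.1.2 _ (left_lt_sup.mpr hJ)))
  have hbJ (g : G) (hg : g • M ≠ M) : b ∈ g • M :=
    (Finset.inf_le (f := fun g : G ↦ g • M) (by simpa using hg) : J ≤ g • M) hb
  have hbM : b - 1 ∈ M := by rw [← hsb]; simpa using hs
  -- its norm down to the decomposition field
  let β : B := ∏ h : MulAction.stabilizer G M, (h : G) • b
  have hβM : β - 1 ∈ M := by
    rw [← Ideal.Quotient.eq, map_prod, map_one]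
    refine Finset.prod_eq_one fun h _ ↦ ?_
    rw [← map_one (Ideal.Quotient.mk M), Ideal.Quotient.eq]
    have := Ideal.smul_mem_pointwise_smul (h : G) _ M hbM
    rwa [smul_sub, smul_one, MulAction.mem_stabilizer_iff.mp h.2] at this
  have hβ1 : β ∉ M := fun h ↦ hM.ne_top ((Ideal.eq_top_iff_one _).mpr
    (by simpa using M.sub_mem h hβM))
  have hβJ (g : G) (hg : g • M ≠ M) : β ∈ g • M := by
    refine Ideal.mem_of_dvd _ (Finset.dvd_prod_of_mem _ (Finset.mem_univ 1)) ?_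
    simpa using hbJ g hg
  have hfix (h : G) (hh : h • M = M) : h • β = β := by
    simp only [β, Finset.smul_prod', smul_smul]
    exact Fintype.prod_equiv (Equiv.mulLeft (⟨h, hh⟩ : MulAction.stabilizer G M)) _ _
      fun _ ↦ rfl
  have hmove (g : G) (hg : g • β ≠ β) : g • β ∈ M := by
    have hgM : g⁻¹ • M ≠ M := fun h ↦ hg (hfix g (by rw [eq_comm, ← inv_smul_eq_iff]; exact h))
    simpa using Ideal.smul_mem_pointwise_smul g _ _ (hβJ g⁻¹ hgM)
  -- the minimal polynomial of `β`
  obtain ⟨P, hP, -, hPm⟩ := lifts_and_natDegree_eq_and_monic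
    ((prodXSubSMul G B β).lifts_iff_coeff_lifts.mpr fun n ↦
      Algebra.IsInvariant.isInvariant (A := A) (G := G) _ fun g ↦ prodXSubSMul.coeff G B β g n)
    (prodXSubSMul.monic G B β)
  obtain ⟨Q, hQ, hQM⟩ : ∃ Q : B[X], prodXSubSMul G B β = (X - C β) * Q ∧ Q.eval 1 ∉ M := by
    refine ⟨∏ g ∈ Finset.univ.erase ((1 : G) : G ⧸ MulAction.stabilizer G β),
      (X - C (MulAction.ofQuotientStabilizer G β g)), ?_, ?_⟩
    · rw [prodXSubSMul, ← Finset.mul_prod_erase _ _ (Finset.mem_univ ((1 : G) : G ⧸ _))]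
      simp
    · rw [eval_prod, hM.isPrime.prod_mem_iff]
      rintro ⟨g, hg, h⟩
      induction g using QuotientGroup.induction_on with | H g => ?_
      have : g • β ∈ M := hmove g fun h ↦ (Finset.mem_erase.mp hg).1
        (QuotientGroup.eq.mpr (by simpa using h)).symm
      refine hM.ne_top ((Ideal.eq_top_iff_one _).mpr ?_)
      simpa using M.add_mem h this
  have hroot : P.eval 1 ∈ maximalIdeal A := by
    rw [← hmem M, ← eval_map_apply, hP, hQ, map_one]
    simpa using Ideal.mul_mem_right (Q.eval 1) _ (neg_mem hβM)
  have hder : IsUnit (P.derivative.eval 1) := by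
    rw [← notMem_maximalIdeal, ← hmem M, ← eval_map_apply, ← derivative_map, hP, hQ, map_one]
    intro h
    refine hQM ?_
    convert add_mem h (Ideal.mul_mem_right (Q.derivative.eval 1) _ hβM) using 1
    simp
    ring
  obtain ⟨a, ha, -⟩ := HenselianLocalRing.is_henselian P hPm 1 hroot hder
  have ha' : (prodXSubSMul G B β).eval (algebraMap A B a) = 0 := by
    rw [← hP, eval_map_apply, ha.eq_zero, map_zero]
  rw [prodXSubSMul, eval_prod, Finset.prod_eq_zero_iff] at ha'
  obtain ⟨g, -, hg⟩ := ha'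
  induction g using QuotientGroup.induction_on with | H g => ?_
  have hβa : β = algebraMap A B a := by
    have : g • β = algebraMap A B a := by
      simpa [sub_eq_zero, eq_comm (a := algebraMap A B a)] using hg
    rw [← inv_smul_eq_iff.mpr this.symm, smul_algebraMap]
  apply hβ1
  rw [hβa, hmem M, ← hmem (τ • M), ← hβa]
  exact hβJ τ hne

/-- A polynomial `X ^ (n + 1) - X ^ n + c S` with `deg S < n` and `c` in the maximal ideal of a
henselian local ring has a root congruent to `1`. -/
theorem HenselianLocalRing.exists_root_X_pow_succ_sub_X_pow {A : Type*} [CommRing A]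
    [HenselianLocalRing A] (n : ℕ) {c : A} (hc : c ∈ maximalIdeal A) (S : A[X])
    (hS : S.degree < n) :
    ∃ z : A, IsUnit z ∧ z ^ (n + 1) - z ^ n + c * S.eval z = 0 := by
  have hlow : (-X ^ n + C c * S : A[X]).degree < (n + 1 : ℕ) := by
    refine (degree_add_le _ _).trans_lt (max_lt ?_ ?_)
    · rw [degree_neg]
      exact (degree_X_pow_le n).trans_lt (by exact_mod_cast n.lt_succ_self)
    · refine (C_mul' c S ▸ degree_smul_le c S).trans_lt (hS.trans ?_)
      exact_mod_cast n.lt_succ_self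
  obtain ⟨z, hz, hz1⟩ := HenselianLocalRing.is_henselian (X ^ (n + 1) + (-X ^ n + C c * S))
    (monic_X_pow_add hlow) 1 (by simpa using Ideal.mul_mem_right _ _ hc) (by
      have : IsUnit (1 + c * S.derivative.eval 1) := by
        rw [← notMem_maximalIdeal]
        intro h
        exact (Ideal.ne_top_iff_one _).mp (maximalIdeal.isMaximal A).ne_top
          (by simpa using sub_mem h (Ideal.mul_mem_right (S.derivative.eval 1) _ hc))
      convert this using 1
      simp [derivative_X_pow]
      ring)
  refine ⟨z, ?_, ?_⟩
  · rw [← notMem_maximalIdeal]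
    intro h
    exact (Ideal.ne_top_iff_one _).mp (maximalIdeal.isMaximal A).ne_top
          (by simpa using sub_mem h hz1)
  · have := hz.eq_zero
    simp only [eval_add, eval_neg, eval_pow, eval_X, eval_mul, eval_C] at this
    linear_combination this

/-- An element of an extension field which, along with its inverse, avoids an integrally closed
local ring only satisfies algebraic equations with all coefficients in the maximal ideal. -/
theorem Polynomial.coeff_mem_maximalIdeal_of_aeval_eq_zero {B L : Type*} [CommRing B]
    [IsLocalRing B] [Field L] [Algebra B L] [IsIntegrallyClosedIn B L] {α : L}
    (h₁ : α ∉ (algebraMap B L).range) (h₂ : α⁻¹ ∉ (algebraMap B L).range) (p : B[X])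
    (hp : aeval α p = 0) (i : ℕ) : p.coeff i ∈ maximalIdeal B := by
  have hinj : Function.Injective (algebraMap B L) :=
    (isIntegrallyClosedIn_iff.mp ‹_›).1
  have hα : α ≠ 0 := by rintro rfl; exact h₁ (zero_mem _)
  induction hm : p.natDegree using Nat.strong_induction_on generalizing p i with | h m IH =>
  obtain (_ | m) := m
  · obtain ⟨r, rfl⟩ := natDegree_eq_zero.mp hm
    obtain rfl : r = 0 := hinj (by simpa using hp)
    simp
  · obtain ⟨a, ha⟩ := IsIntegrallyClosedIn.isIntegral_iff.mp (isIntegral_leadingCoeff_smul p α hp)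
    rw [Algebra.smul_def] at ha
    have hlead : p.leadingCoeff ∈ maximalIdeal B := by
      rintro ⟨u, hu⟩
      refine h₁ ⟨↑u⁻¹ * a, ?_⟩
      rw [map_mul, ha, ← hu, ← mul_assoc, ← map_mul]
      simp
    have ham : a ∈ maximalIdeal B := by
      rintro ⟨u, hu⟩
      refine h₂ ⟨↑u⁻¹ * p.leadingCoeff, ?_⟩
      refine eq_inv_of_mul_eq_one_left ?_
      rw [map_mul, mul_assoc, ← ha, ← hu, ← map_mul]
      simp
    have key := IH _ ?_ (p.eraseLead + C a * X ^ m) ?_ i rfl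
    · by_cases hi : i = p.natDegree
      · rw [hi]; exact hlead
      · rw [coeff_add, eraseLead_coeff_of_ne _ hi, coeff_C_mul] at key
        exact (Ideal.add_mem_iff_left _ (Ideal.mul_mem_right _ _ ham)).mp key
    · suffices p.eraseLead.natDegree ≤ m by
        have : (p.eraseLead + C a * X ^ m).natDegree ≤ m := by compute_degree!
        omega
      exact (eraseLead_natDegree_le ..).trans (by lia)
    · simp [← self_sub_monomial_natDegree_leadingCoeff, hp, hm, pow_succ', ha, mul_assoc]

/-- The characteristic polynomial of an integral matrix has integral coefficients. -/
theorem Matrix.isIntegral_coeff_charpoly {A K ι : Type*} [CommRing A] [Field K] [Algebra A K]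
    [Fintype ι] [DecidableEq ι] {M : Matrix ι ι K} (hM : IsIntegral A M) (i : ℕ) :
    IsIntegral A (M.charpoly.coeff i) := by
  let E := AlgebraicClosure K
  rw [← isIntegral_algebraMap_iff (algebraMap K E).injective, ← coeff_map]
  have hmon := M.charpoly_monic.map (algebraMap K E)
  refine isIntegral_coeff_of_factors _ (by rw [hmon.leadingCoeff]; exact isIntegral_one)
    (IsAlgClosed.splits _) (fun r hr ↦ ?_) i
  obtain ⟨p, hpm, hp⟩ := hM
  refine ⟨p, hpm, ?_⟩
  rw [← Matrix.charpoly_map] at hr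
  have hspec := spectrum.subset_polynomial_aeval (M.map (algebraMap K E)) (p.map (algebraMap A E))
    ⟨r, Matrix.mem_spectrum_of_isRoot_charpoly hr, rfl⟩
  have hzero : aeval (M.map (algebraMap K E)) (p.map (algebraMap A E)) = 0 := by
    rw [aeval_map_algebraMap]
    exact (aeval_algHom_apply (IsScalarTower.toAlgHom A K E).mapMatrix M p).trans
      ((congrArg _ hp).trans (map_zero _))
  cases isEmpty_or_nonempty ι
  · simp [Matrix.charpoly] at hr
  rw [hzero, spectrum.zero_eq] at hspec
  simpa [aeval_def] using hspec

/-- The integral closure of a henselian local ring in a finite Galois extension is local. -/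
theorem integralClosure.isLocalRing_of_isGalois (A K L : Type*) [CommRing A]
    [HenselianLocalRing A] [IsIntegrallyClosed A] [IsDomain A] [Field K] [Field L] [Algebra A K]
    [IsFractionRing A K] [Algebra K L] [Algebra A L] [IsScalarTower A K L] [FiniteDimensional K L]
    [IsGalois K L] : IsLocalRing (integralClosure A L) := by
  have : IsFractionRing (integralClosure A L) L :=
    integralClosure.isFractionRing_of_finite_extension K L
  have := Algebra.isInvariant_of_isGalois' A K L (integralClosure A L)
  have : Finite (integralClosure A L ≃ₐ[A] integralClosure A L) :=
    .of_equiv _ (galRestrict A K L (integralClosure A L)).toEquiv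
  exact .of_isInvariant_of_henselian A (integralClosure A L)
    (integralClosure A L ≃ₐ[A] integralClosure A L)

/-- The integral closure of a henselian local ring in a finite separable extension is local. -/
theorem integralClosure.isLocalRing_of_isSeparable (A K L : Type*) [CommRing A]
    [HenselianLocalRing A] [IsIntegrallyClosed A] [IsDomain A] [Field K] [Field L] [Algebra A K]
    [IsFractionRing A K] [Algebra K L] [Algebra A L] [IsScalarTower A K L] [FiniteDimensional K L]
    [Algebra.IsSeparable K L] : IsLocalRing (integralClosure A L) := by
  let N := IntermediateField.normalClosure K L (SeparableClosure K)
  have hfin : FiniteDimensional K N := normalClosure.is_finiteDimensional K L _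
  have hloc : IsLocalRing (integralClosure A N) := isLocalRing_of_isGalois A K N
  let ψ : L →ₐ[K] SeparableClosure K := IsSepClosed.lift
  let φ : L →ₐ[A] N := (ψ.codRestrict N.toSubalgebra
    fun x ↦ ψ.fieldRange_le_normalClosure ⟨x, rfl⟩).restrictScalars A
  have hunit (x : integralClosure A L)
      (hx : IsUnit (φ.mapIntegralClosure x : integralClosure A N)) : IsUnit x := by
    obtain ⟨y, hy⟩ := hx.exists_right_inv
    have hxy : φ x * y = 1 := congrArg Subtype.val hy
    have hinv : φ (x : L)⁻¹ = y := by rw [map_inv₀]; exact inv_eq_of_mul_eq_one_right hxy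
    have hx0 : (x : L) ≠ 0 := by
      intro h
      rw [h, map_zero, zero_mul] at hxy
      exact zero_ne_one hxy
    refine .of_mul_eq_one ⟨(x : L)⁻¹, ?_⟩ (Subtype.ext (mul_inv_cancel₀ hx0))
    refine (isIntegral_algHom_iff φ φ.toRingHom.injective).mp ?_
    rw [hinv]
    exact y.2
  refine .of_isUnit_or_isUnit_one_sub_self fun x ↦ ?_
  refine (isUnit_or_isUnit_one_sub_self (φ.mapIntegralClosure x)).imp (hunit x) fun h ↦ ?_
  exact hunit _ (by rwa [map_sub, map_one])

/-- The norm of `z + e α`, expanded in terms of the characteristic polynomial of `α`. -/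
theorem Algebra.norm_algebraMap_add_mul_eq_sum {K L ι : Type*} [Field K] [Field L] [Algebra K L]
    [Fintype ι] [DecidableEq ι] (b : Module.Basis ι K L) (α : L) (z : K) {e : K} (he : e ≠ 0) :
    Algebra.norm K (algebraMap K L z + algebraMap K L e * α) =
      ∑ i ∈ Finset.range (Module.finrank K L + 1),
        (-e) ^ (Module.finrank K L - i) * (Algebra.leftMulMatrix b α).charpoly.coeff i * z ^ i := by
  have he' : -e ≠ 0 := neg_ne_zero.mpr he
  set M := Algebra.leftMulMatrix b α
  have hcard := Module.finrank_eq_card_basis b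
  have hM : Algebra.leftMulMatrix b (algebraMap K L z + algebraMap K L e * α) =
      (-e) • (Matrix.scalar ι (z / -e) - M) := by
    rw [map_add, map_mul, AlgHom.commutes, AlgHom.commutes, smul_sub, ← Algebra.smul_def,
      sub_eq_add_neg, neg_smul, neg_smul, neg_neg]
    congr 1
    ext i j
    by_cases hij : i = j <;> simp [hij, Matrix.algebraMap_matrix_apply]
    field_simp
  rw [Algebra.norm_eq_matrix_det b, hM, Matrix.det_smul, ← Matrix.eval_charpoly,
    eval_eq_sum_range, Matrix.charpoly_natDegree_eq_dim, ← hcard, Finset.mul_sum]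
  refine Finset.sum_congr rfl fun i hi ↦ ?_
  have hi' : i ≤ Module.finrank K L := Nat.lt_succ_iff.mp (Finset.mem_range.mp hi)
  rw [div_pow, ← Nat.sub_add_cancel hi', pow_add, Nat.add_sub_cancel]
  field_simp

section Valuation

variable {K L Γ : Type*} [Field K] [Field L] [Algebra K L]
  [LinearOrderedCommGroupWithZero Γ] {v : Valuation K Γ} {w : Valuation L Γ}

theorem Valuation.mem_maximalIdeal_valuationSubring_iff {a : v.valuationSubring} :
    a ∈ maximalIdeal v.valuationSubring ↔ v a < 1 := by
  have hv : v.Integers v.valuationSubring := Valuation.integer.integers v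
  rw [mem_maximalIdeal, mem_nonunits_iff, hv.isUnit_iff_valuation_eq_one]
  exact ⟨fun h ↦ lt_of_le_of_ne a.2 h, fun h ↦ h.ne⟩

theorem Valuation.le_one_of_isIntegral (hext : ∀ x : K, w (algebraMap K L x) = v x) {α : L}
    (hα : IsIntegral v.valuationSubring α) : w α ≤ 1 := by
  refine (Valuation.integer.integers w).mem_of_integral ?_
  let f : v.valuationSubring →+* w.integer :=
    ((algebraMap K L).comp v.valuationSubring.subtype).codRestrict w.integer fun a ↦
      (hext a).trans_le a.2
  obtain ⟨p, hp, hp0⟩ := hα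
  exact ⟨p.map f, hp.map f, by rw [eval₂_map]; exact hp0⟩

/-- Every algebraic element over the fraction field of a valuation ring satisfies a polynomial
equation having a coefficient equal to `1`. -/
theorem Valuation.exists_aeval_eq_zero_coeff_eq_one [Algebra.IsAlgebraic K L] (v : Valuation K Γ)
    (α : L) : ∃ p : v.valuationSubring[X], aeval α p = 0 ∧ ∃ i, p.coeff i = 1 := by
  obtain ⟨q, hq, hq0⟩ := (IsFractionRing.isAlgebraic_iff v.valuationSubring K L).mpr
    (Algebra.IsAlgebraic.isAlgebraic (R := K) α)
  obtain ⟨i, hi, hmax⟩ := q.support.exists_max_image (fun i ↦ v (q.coeff i))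
    (support_nonempty.mpr hq)
  have hv : v.Integers v.valuationSubring := Valuation.integer.integers v
  have hdvd : C (q.coeff i) ∣ q := C_dvd_iff_dvd_coeff _ _ |>.mpr fun j ↦ by
    by_cases hj : j ∈ q.support
    · exact hv.dvd_of_le (hmax j hj)
    · rw [notMem_support_iff.mp hj]
      exact dvd_zero _
  have hi0 : q.coeff i ≠ 0 := mem_support_iff.mp hi
  obtain ⟨p, hp⟩ := hdvd
  refine ⟨p, ?_, i, ?_⟩
  · rw [hp, map_mul, aeval_C, mul_eq_zero, or_iff_right] at hq0
    · exact hq0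
    · rwa [FaithfulSMul.algebraMap_eq_zero_iff]
  · have : q.coeff i * p.coeff i = q.coeff i * 1 := by
      rw [← coeff_C_mul, ← hp, mul_one]
    exact mul_left_cancel₀ hi0 this

variable [FiniteDimensional K L] [HenselianLocalRing v.valuationSubring]

/-- The valuation ring of an extension of a henselian valuation to a finite separable extension
is integral over the base. -/
theorem Valuation.isIntegral_of_le_one_of_henselian [Algebra.IsSeparable K L]
    (hext : ∀ x : K, w (algebraMap K L x) = v x) {α : L} (hα : w α ≤ 1) :
    IsIntegral v.valuationSubring α := by
  let A := v.valuationSubring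
  let B := integralClosure A L
  have hB : IsLocalRing B := integralClosure.isLocalRing_of_isSeparable A K L
  by_contra hint
  have h₁ : α ∉ (algebraMap B L).range := by
    rintro ⟨b, rfl⟩
    exact hint b.2
  have h₂ : α⁻¹ ∈ (algebraMap B L).range := by
    by_contra h₂
    obtain ⟨p, hp, i, hi⟩ := v.exists_aeval_eq_zero_coeff_eq_one α
    have := coeff_mem_maximalIdeal_of_aeval_eq_zero h₁ h₂ (p.map (algebraMap A B))
      (by rwa [aeval_map_algebraMap]) i
    rw [coeff_map, hi, map_one] at this
    exact (Ideal.ne_top_iff_one _).mp (maximalIdeal.isMaximal B).ne_top this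
  obtain ⟨b, hb⟩ := h₂
  have hα0 : α ≠ 0 := by rintro rfl; exact hint isIntegral_zero
  have hbm : b ∈ maximalIdeal B := by
    rintro ⟨u, rfl⟩
    refine h₁ ⟨(u⁻¹ : Bˣ), ?_⟩
    rw [← inv_inj, ← hb]
    refine inv_eq_of_mul_eq_one_right ?_
    rw [← map_mul]
    simp
  let f : B →+* w.valuationSubring := (algebraMap B L).codRestrict _ fun b ↦
    Valuation.le_one_of_isIntegral hext b.2
  let Q := (maximalIdeal w.valuationSubring).comap f
  have hQ : Q.comap (algebraMap A B) = maximalIdeal A := by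
    ext a
    rw [Valuation.mem_maximalIdeal_valuationSubring_iff, ← hext]
    exact Valuation.mem_maximalIdeal_valuationSubring_iff
  have hQm : Q = maximalIdeal B := eq_maximalIdeal
    (Ideal.isMaximal_of_isIntegral_of_isMaximal_comap (R := A) Q
      (hQ ▸ maximalIdeal.isMaximal A))
  rw [← hQm] at hbm
  have : w α⁻¹ < 1 := by
    rw [← hb]
    exact Valuation.mem_maximalIdeal_valuationSubring_iff.mp hbm
  rw [map_inv₀, inv_lt_one₀ (by simpa [zero_lt_iff] using hα0)] at this
  exact this.not_ge hα

/-- If `α` is integral with nonzero trace `t`, then every `1 + x` with `v x < v t ^ 2` is a norm. -/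
theorem Valuation.exists_norm_eq_one_add_of_henselian {α : L}
    (hα : IsIntegral v.valuationSubring α) (ht : Algebra.trace K L α ≠ 0) {x : K}
    (hx : v x < v (Algebra.trace K L α) ^ 2) : ∃ y : L, y ≠ 0 ∧ Algebra.norm K y = 1 + x := by
  classical
  obtain rfl | hx0 := eq_or_ne x 0
  · exact ⟨1, one_ne_zero, by simp⟩
  let A := v.valuationSubring
  set t := Algebra.trace K L α with ht_def
  obtain ⟨n, hn⟩ : ∃ n, Module.finrank K L = n + 1 :=
    Nat.exists_eq_succ_of_ne_zero Module.finrank_pos.ne'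
  let b := Module.finBasisOfFinrankEq K L hn
  let M := Algebra.leftMulMatrix b α
  have hdeg : M.charpoly.natDegree = n + 1 := by simp
  have hcoeff (i : ℕ) : v (M.charpoly.coeff i) ≤ 1 :=
    (Valuation.integer.integers v).mem_of_integral
      (Matrix.isIntegral_coeff_charpoly (hα.map ((Algebra.leftMulMatrix b).restrictScalars A)) i)
  have htM : M.charpoly.coeff n = -t := by
    rw [ht_def, Algebra.trace_eq_matrix_trace b, Matrix.trace_eq_neg_charpoly_coeff]
    simp [M]
  have ht1 : v t ≤ 1 := by simpa [htM] using hcoeff n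
  have hvt : 0 < v t := by simpa [zero_lt_iff] using ht
  have hvx : v x < v t := hx.trans_le (by
    rw [pow_two]; exact mul_le_of_le_one_left' ht1)
  have hx1 : 1 + x ≠ 0 := by
    intro h
    rw [← neg_eq_of_add_eq_zero_right h, Valuation.map_neg, map_one] at hvx
    exact hvx.not_ge ht1
  let e : A := ⟨x / t, by
    rw [Valuation.mem_valuationSubring_iff, map_div₀]
    exact div_le_one_of_le₀ hvx.le zero_le⟩
  have hc1 : v (x / t ^ 2) < 1 := by
    rw [map_div₀, map_pow]
    exact (div_lt_one₀ (pow_pos hvt 2)).mpr hx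
  let c : A := ⟨x / t ^ 2, hc1.le⟩
  have hc : c ∈ maximalIdeal A := Valuation.mem_maximalIdeal_valuationSubring_iff.mpr hc1
  let q (i : ℕ) : A := ⟨M.charpoly.coeff i, hcoeff i⟩
  let S : A[X] := ∑ i ∈ Finset.range n, C (-((-e) ^ (n - 1 - i) * q i)) * X ^ i
  have hS : S.degree < n := by
    refine (degree_sum_le _ _).trans_lt ((Finset.sup_lt_iff (WithBot.bot_lt_coe n)).mpr ?_)
    intro i hi
    exact (degree_C_mul_X_pow_le _ _).trans_lt (WithBot.coe_lt_coe.mpr (Finset.mem_range.mp hi))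
  obtain ⟨z, hzu, hz⟩ := HenselianLocalRing.exists_root_X_pow_succ_sub_X_pow n hc S hS
  have hz0 : (z : K) ≠ 0 := by
    simpa using hzu.ne_zero
  have he0 : (e : K) ≠ 0 := div_ne_zero hx0 ht
  have hnorm : Algebra.norm K (algebraMap K L z + algebraMap K L e * α) = (1 + x) * z ^ (n + 1) := by
    rw [Algebra.norm_algebraMap_add_mul_eq_sum b α z he0, hn, Finset.sum_range_succ,
      Finset.sum_range_succ]
    have hz' := congrArg ((↑) : A → K) hz
    simp only [S, eval_finsetSum, eval_mul, eval_C, eval_pow, eval_X] at hz'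
    push_cast at hz'
    have hxc : x * c = (e : K) ^ 2 := by
      simp only [c, e]
      field_simp
    have hsum : ∑ i ∈ Finset.range n, (-(e : K)) ^ (n + 1 - i) * M.charpoly.coeff i * z ^ i =
        -(x * c) * ∑ i ∈ Finset.range n, -((-(e : K)) ^ (n - 1 - i) * q i) * z ^ i := by
      rw [hxc, Finset.mul_sum]
      refine Finset.sum_congr rfl fun i hi ↦ ?_
      rw [show n + 1 - i = n - 1 - i + 2 by have := Finset.mem_range.mp hi; omega]
      ring
    have het : (e : K) * t = x := div_mul_cancel₀ x ht
    have hlead : M.charpoly.coeff (n + 1) = 1 := by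
      simpa only [hdeg] using M.charpoly_monic.coeff_natDegree
    rw [hsum, htM, hlead, Nat.sub_self, Nat.add_sub_cancel_left]
    linear_combination (-x) * hz' + (z : K) ^ n * het
  have hN : Algebra.norm K ((algebraMap K L z + algebraMap K L e * α) / algebraMap K L z)
      = 1 + x := by
    rw [div_eq_mul_inv, ← map_inv₀, map_mul, hnorm, Algebra.norm_algebraMap, hn, inv_pow]
    exact mul_inv_cancel_right₀ (pow_ne_zero _ hz0) _
  refine ⟨_, fun h ↦ hx1 ?_, hN⟩
  rw [← hN, h, Algebra.norm_zero]

end Valuation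

/-- Norms of a finite separable extension of henselian valued fields form an open
subgroup: the image of N_{L/K} : L^× → K^× is open in the v-adic topology, and more
precisely, if α ∈ 𝒪_w has Tr_{L/K}(α) ≠ 0, then every x ∈ K with
v(x) > 2·v(Tr_{L/K}(α)) (multiplicatively: v x < v(Tr α)²) satisfies
1 + x ∈ N_{L/K}(L^×). -/
theorem stmt_9 (K : Type*) [Field K] (L : Type*) [Field L] [Algebra K L]
    [FiniteDimensional K L] [Algebra.IsSeparable K L]
    (Γ : Type*) [LinearOrderedCommGroupWithZero Γ]
    (v : Valuation K Γ) (w : Valuation L Γ)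
    [HenselianLocalRing ↥v.valuationSubring] [HenselianLocalRing ↥w.valuationSubring]
    (hext : ∀ x : K, w (algebraMap K L x) = v x) :
    (∀ z : K, (∃ y : L, y ≠ 0 ∧ Algebra.norm K y = z) →
      ∃ γ : Γˣ, ∀ z' : K, v (z' - z) < γ → ∃ y : L, y ≠ 0 ∧ Algebra.norm K y = z') ∧
    (∀ α : L, w α ≤ 1 → Algebra.trace K L α ≠ 0 →
      ∀ x : K, v x < v (Algebra.trace K L α) ^ 2 →
        ∃ y : L, y ≠ 0 ∧ Algebra.norm K y = 1 + x) := by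
  have hsecond (α : L) (hα : w α ≤ 1) (ht : Algebra.trace K L α ≠ 0) (x : K)
      (hx : v x < v (Algebra.trace K L α) ^ 2) : ∃ y : L, y ≠ 0 ∧ Algebra.norm K y = 1 + x :=
    Valuation.exists_norm_eq_one_add_of_henselian
      (Valuation.isIntegral_of_le_one_of_henselian hext hα) ht hx
  refine ⟨?_, hsecond⟩
  rintro _ ⟨y, hy, rfl⟩
  obtain ⟨α₀, hα₀⟩ := Algebra.trace_surjective K L 1
  obtain ⟨a, ha, hint⟩ := ((IsFractionRing.isAlgebraic_iff v.valuationSubring K L).mpr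
    (Algebra.IsAlgebraic.isAlgebraic (R := K) α₀)).exists_integral_multiple
  have htr : Algebra.trace K L (a • α₀) = a := by
    have : a • α₀ = (a : K) • α₀ := rfl
    rw [this, map_smul, hα₀, smul_eq_mul, mul_one]
  have ha0 : (a : K) ≠ 0 := by simpa using ha
  have hz : Algebra.norm K y ≠ 0 := Algebra.norm_ne_zero_iff.mpr hy
  refine ⟨Units.mk0 (v (Algebra.norm K y) * v a ^ 2) (by simp [hz, ha0]), fun z' hz' ↦ ?_⟩
  obtain ⟨u, hu, hnu⟩ := hsecond (a • α₀) (Valuation.le_one_of_isIntegral hext hint)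
    (htr ▸ ha0) ((z' - Algebra.norm K y) / Algebra.norm K y) (by
      rw [htr, map_div₀, div_lt_iff₀ (by simpa [zero_lt_iff] using hz), mul_comm]
      exact hz')
  refine ⟨y * u, mul_ne_zero hy hu, ?_⟩
  rw [map_mul, hnu]
  field_simp
  ring
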